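/- arXiv:math/0403062 — 3 statements merged into one kernel-verified Lean document; each statement's English description precedes it below -/
import Mathlib

section
/- Let R be a finite ring in which every one-sided identity element is a two-sided identity. Then for every pair of distinct vertices x, y ∈ Z(R)*, there is a directed path from x to y in Γ(R) of length at most 3. -/
variable {R : Type*} [NonUnitalRing R]

/-- `x` is a left zero-divisor. -/
def IsLeftZD (x : R) : Prop := ∃ y : R, y ≠ 0 ∧ x * y = 0

/-- `x` is a right zero-divisor. -/
def IsRightZD (x : R) : Prop := ∃ y : R, y ≠ 0 ∧ y * x = 0

/-- `x` is a vertex of the directed zero-divisor graph `Γ(R)`,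
i.e. a nonzero (one-sided) zero-divisor. -/
def IsVertex (x : R) : Prop := x ≠ 0 ∧ (IsLeftZD x ∨ IsRightZD x)

/-- Directed edge `x → y` of `Γ(R)`: distinct vertices with `x * y = 0`. -/
def Edge (x y : R) : Prop := IsVertex x ∧ IsVertex y ∧ x ≠ y ∧ x * y = 0

/-- A sink of `Γ(R)`: a vertex with positive in-degree and zero out-degree. -/
def IsSink (x : R) : Prop :=
  IsVertex x ∧ (∃ y : R, IsVertex y ∧ y ≠ x ∧ y * x = 0) ∧
    ¬ ∃ y : R, IsVertex y ∧ y ≠ x ∧ x * y = 0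

/-- A source of `Γ(R)`: a vertex with positive out-degree and zero in-degree. -/
def IsSource (x : R) : Prop :=
  IsVertex x ∧ (∃ y : R, IsVertex y ∧ y ≠ x ∧ x * y = 0) ∧
    ¬ ∃ y : R, IsVertex y ∧ y ≠ x ∧ y * x = 0

/-- `e` is a left identity of `R`. -/
def IsLeftId (e : R) : Prop := ∀ x : R, e * x = x

/-- `e` is a right identity of `R`. -/
def IsRightId (e : R) : Prop := ∀ x : R, x * e = x

/-- There is a directed path of length `n` from `x` to `y` in `Γ(R)`. -/
def HasPathLen (n : ℕ) (x y : R) : Prop :=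
  ∃ f : ℕ → R, f 0 = x ∧ f n = y ∧ ∀ i < n, Edge (f i) (f (i + 1))

/-- In a finite ring whose left identities are right identities, vertices are left zero-divisors. -/
theorem IsVertex.isLeftZD {R : Type*} [NonUnitalRing R] [Finite R]
    (hid : ∀ e : R, IsLeftId e → IsRightId e) {x : R} (hx : IsVertex x) : IsLeftZD x := by
  by_contra hl
  have hcancel : ∀ y, x * y = 0 → y = 0 := fun y h => by
    by_contra hy
    exact hl ⟨y, hy, h⟩
  obtain ⟨z, hz, hzx⟩ := hx.2.resolve_left hl
  have hinj : Function.Injective (x * ·) := fun a b h =>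
    sub_eq_zero.1 (hcancel _ (by rw [mul_sub, sub_eq_zero]; exact h))
  have hsurj := Finite.surjective_of_injective hinj
  obtain ⟨e, he⟩ := hsurj x
  obtain ⟨u, hu⟩ := hsurj e
  simp only at he hu
  have hleft : IsLeftId e := fun r => hinj (by simp only; rw [← mul_assoc, he])
  exact hz (by rw [← hid e hleft z, ← hu, ← mul_assoc, hzx, zero_mul])

/-- In a finite ring whose right identities are left identities, vertices are right zero-divisors. -/
theorem IsVertex.isRightZD {R : Type*} [NonUnitalRing R] [Finite R]
    (hid : ∀ e : R, IsRightId e → IsLeftId e) {x : R} (hx : IsVertex x) : IsRightZD x := by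
  by_contra hr
  have hcancel : ∀ y, y * x = 0 → y = 0 := fun y h => by
    by_contra hy
    exact hr ⟨y, hy, h⟩
  obtain ⟨z, hz, hxz⟩ := hx.2.resolve_right hr
  have hinj : Function.Injective (· * x) := fun a b h =>
    sub_eq_zero.1 (hcancel _ (by rw [sub_mul, sub_eq_zero]; exact h))
  have hsurj := Finite.surjective_of_injective hinj
  obtain ⟨e, he⟩ := hsurj x
  obtain ⟨u, hu⟩ := hsurj e
  simp only at he hu
  have hright : IsRightId e := fun r => hinj (by simp only; rw [mul_assoc, he])
  exact hz (by rw [← hid e hright z, ← hu, mul_assoc, hxz, mul_zero])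

theorem HasPathLen.zero {R : Type*} [NonUnitalRing R] (x : R) : HasPathLen 0 x x :=
  ⟨fun _ => x, rfl, rfl, by simp⟩

theorem HasPathLen.cons {R : Type*} [NonUnitalRing R] {n : ℕ} {x y z : R}
    (h : Edge x y) (p : HasPathLen n y z) : HasPathLen (n + 1) x z := by
  obtain ⟨f, h0, hn, hf⟩ := p
  refine ⟨fun i => Nat.casesOn i x f, rfl, hn, fun i hi => ?_⟩
  cases i with
  | zero => simpa [h0] using h
  | succ i => exact hf i (by omega)

theorem stmt4 {R : Type*} [NonUnitalRing R] [Fintype R]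
    (hid : ∀ e : R, (IsLeftId e → IsRightId e) ∧ (IsRightId e → IsLeftId e))
    (x y : R) (hx : IsVertex x) (hy : IsVertex y) (hxy : x ≠ y) :
    ∃ n : ℕ, 1 ≤ n ∧ n ≤ 3 ∧ HasPathLen n x y := by
  by_cases h : x * y = 0
  · exact ⟨1, le_rfl, by norm_num, .cons ⟨hx, hy, hxy, h⟩ (.zero y)⟩
  have two_step : ∀ c : R, c ≠ 0 → x * c = 0 → c * y = 0 →
      ∃ n : ℕ, 1 ≤ n ∧ n ≤ 3 ∧ HasPathLen n x y := fun c hc hxc hcy => by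
    have hcv : IsVertex c := ⟨hc, .inr ⟨x, hx.1, hxc⟩⟩
    refine ⟨2, by norm_num, by norm_num,
      .cons ⟨hx, hcv, ?_, hxc⟩ (.cons ⟨hcv, hy, ?_, hcy⟩ (.zero y))⟩
    · rintro rfl
      exact h hcy
    · rintro rfl
      exact h hxc
  obtain ⟨a, ha, hxa⟩ := hx.isLeftZD fun e => (hid e).1
  obtain ⟨b, hb, hby⟩ := hy.isRightZD fun e => (hid e).2
  by_cases hab : a * b = 0
  · by_cases hax : x = a
    · exact two_step b hb (hax ▸ hab) hby
    by_cases hbe : b = y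
    · exact two_step a ha hxa (hbe ▸ hab)
    by_cases hne : a = b
    · exact two_step a ha hxa (hne ▸ hby)
    have hav : IsVertex a := ⟨ha, .inl ⟨b, hb, hab⟩⟩
    have hbv : IsVertex b := ⟨hb, .inr ⟨a, ha, hab⟩⟩
    exact ⟨3, by norm_num, le_rfl, .cons ⟨hx, hav, hax, hxa⟩
      (.cons ⟨hav, hbv, hne, hab⟩ (.cons ⟨hbv, hy, hbe, hby⟩ (.zero y)))⟩
  · exact two_step (a * b) hab (by rw [← mul_assoc, hxa, zero_mul])
      (by rw [mul_assoc, hby, mul_zero])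
end

section
/- Let R be any ring with at least five elements. Then Sink(R) = Z_r(R) \ Z_l(R) and Sour(R) = Z_l(R) \ Z_r(R); consequently Z(R)* is the disjoint union of Sour(R), the set of nonzero elements of Z_r(R) ∩ Z_l(R), and Sink(R). -/
variable {R : Type*} [NonUnitalRing R]

theorem AddMonoidHom.card_le_four_of_ker_subset_pair {G : Type*} [AddCommGroup G] (f : G →+ G)
    (x : G) (hker : ∀ y, f y = 0 → y = 0 ∨ y = x) (hsq : ∀ y, f (f y) = 0) (s : Finset G) :
    s.card ≤ 4 := by
  classical
  by_cases hr : ∃ r, f r = x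
  · obtain ⟨r, hr⟩ := hr
    refine (Finset.card_le_card (t := {0, x, r, x + r}) fun y _ => ?_).trans Finset.card_le_four
    simp only [Finset.mem_insert, Finset.mem_singleton]
    rcases hker _ (hsq y) with h | h
    · rcases hker y h with h | h <;> simp [h]
    · rcases hker (y - r) (by rw [map_sub, h, hr, sub_self]) with h | h
      · simp [sub_eq_zero.mp h]
      · simp [sub_eq_iff_eq_add.mp h]
  · refine (Finset.card_le_card (t := {0, x}) fun y _ => ?_).trans
      (Finset.card_le_two.trans (by norm_num))
    simp only [Finset.mem_insert, Finset.mem_singleton]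
    exact hker y ((hker _ (hsq y)).resolve_right fun h => hr ⟨y, h⟩)

theorem isSink_iff {R : Type*} [NonUnitalRing R] (hcard : ∃ s : Finset R, 5 ≤ s.card) (x : R) :
    IsSink x ↔ IsRightZD x ∧ ¬ IsLeftZD x := by
  constructor
  · rintro ⟨⟨hx, -⟩, ⟨y, ⟨hy, -⟩, -, hyx⟩, hout⟩
    refine ⟨⟨y, hy, hyx⟩, ?_⟩
    have hker : ∀ z, x * z = 0 → z = 0 ∨ z = x := fun z hz => by
      by_contra! h
      exact hout ⟨z, ⟨h.1, .inr ⟨x, hx, hz⟩⟩, h.2, hz⟩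
    rintro ⟨z, hz, hxz⟩
    have hsq : x * x = 0 := by
      rwa [(hker z hxz).resolve_left hz] at hxz
    obtain ⟨s, hs⟩ := hcard
    have := (AddMonoidHom.mulLeft x).card_le_four_of_ker_subset_pair x hker
      (fun y => by simp [← mul_assoc, hsq]) s
    omega
  · rintro ⟨⟨y, hy, hyx⟩, hl⟩
    have hx : x ≠ 0 := fun h => hl ⟨y, hy, by rw [h, zero_mul]⟩
    refine ⟨⟨hx, .inr ⟨y, hy, hyx⟩⟩, ⟨y, ⟨hy, .inl ⟨x, hx, hyx⟩⟩, ?_, hyx⟩, ?_⟩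
    · rintro rfl
      exact hl ⟨y, hy, hyx⟩
    · rintro ⟨z, ⟨hz, -⟩, -, hxz⟩
      exact hl ⟨z, hz, hxz⟩

theorem isSource_iff {R : Type*} [NonUnitalRing R] (hcard : ∃ s : Finset R, 5 ≤ s.card) (x : R) :
    IsSource x ↔ IsLeftZD x ∧ ¬ IsRightZD x := by
  constructor
  · rintro ⟨⟨hx, -⟩, ⟨y, ⟨hy, -⟩, -, hxy⟩, hin⟩
    refine ⟨⟨y, hy, hxy⟩, ?_⟩
    have hker : ∀ z, z * x = 0 → z = 0 ∨ z = x := fun z hz => by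
      by_contra! h
      exact hin ⟨z, ⟨h.1, .inl ⟨x, hx, hz⟩⟩, h.2, hz⟩
    rintro ⟨z, hz, hzx⟩
    have hsq : x * x = 0 := by
      rwa [(hker z hzx).resolve_left hz] at hzx
    obtain ⟨s, hs⟩ := hcard
    have := (AddMonoidHom.mulRight x).card_le_four_of_ker_subset_pair x hker
      (fun y => by simp [mul_assoc, hsq]) s
    omega
  · rintro ⟨⟨y, hy, hxy⟩, hr⟩
    have hx : x ≠ 0 := fun h => hr ⟨y, hy, by rw [h, mul_zero]⟩
    refine ⟨⟨hx, .inl ⟨y, hy, hxy⟩⟩, ⟨y, ⟨hy, .inr ⟨x, hx, hxy⟩⟩, ?_, hxy⟩, ?_⟩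
    · rintro rfl
      exact hr ⟨y, hy, hxy⟩
    · rintro ⟨z, ⟨hz, -⟩, -, hzx⟩
      exact hr ⟨z, hz, hzx⟩

theorem stmt16 {R : Type*} [NonUnitalRing R]
    (hcard : ∃ s : Finset R, 5 ≤ s.card) :
    ({x : R | IsSink x} = {x : R | IsRightZD x} \ {x : R | IsLeftZD x}) ∧
    ({x : R | IsSource x} = {x : R | IsLeftZD x} \ {x : R | IsRightZD x}) ∧
    ({x : R | IsVertex x} =
      {x : R | IsSource x} ∪
        (({x : R | IsRightZD x} ∩ {x : R | IsLeftZD x}) \ {0}) ∪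
        {x : R | IsSink x}) ∧
    Disjoint {x : R | IsSource x}
      (({x : R | IsRightZD x} ∩ {x : R | IsLeftZD x}) \ {0}) ∧
    Disjoint {x : R | IsSink x}
      (({x : R | IsRightZD x} ∩ {x : R | IsLeftZD x}) \ {0}) ∧
    Disjoint {x : R | IsSource x} {x : R | IsSink x} := by 
  have hsink := isSink_iff hcard
  have hsource := isSource_iff hcard
  refine ⟨Set.ext hsink, Set.ext hsource, ?_, ?_, ?_, ?_⟩
  · ext x
    have h₁ : IsSink x → x ≠ 0 := fun h => h.1.1
    have h₂ : IsSource x → x ≠ 0 := fun h => h.1.1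
    simp only [Set.mem_union, Set.mem_sdiff, Set.mem_inter_iff, Set.mem_ofPred_eq,
      Set.mem_singleton_iff, IsVertex]
    have := hsink x
    have := hsource x
    tauto
  · exact Set.disjoint_left.mpr fun x hx h => ((hsource x).mp hx).2 h.1.1
  · exact Set.disjoint_left.mpr fun x hx h => ((hsink x).mp hx).2 h.1.2
  · exact Set.disjoint_left.mpr fun x hx h => ((hsource x).mp hx).2 ((hsink x).mp h).1
end

section
/- Let R be any ring with at least five elements. Then R contains a proper left identity element if and only if Sink(R) ≠ ∅ and there exists x ∈ Sink(R) with x·Sink(R) = Sink(R) (i.e., {xs : s ∈ Sink(R)} = Sink(R)). In this case, Γ(R) contains no source and Sink(R) contains at least two elements. -/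
variable {R : Type*} [NonUnitalRing R]

/-- An additive map of a group with at least five elements taking at most the values `0` and `n`
has a kernel element other than `0` and `n`. -/
theorem AddMonoidHom.exists_map_eq_zero_of_forall_map_eq_or {G : Type*} [AddCommGroup G]
    (hcard : ∃ s : Finset G, 5 ≤ s.card) (f : G →+ G) (n : G)
    (hf : ∀ r, f r = 0 ∨ f r = n) : ∃ y, y ≠ 0 ∧ y ≠ n ∧ f y = 0 := by
  classical
  obtain ⟨s, hs⟩ := hcard
  have hmaps : ∀ a ∈ s, f a ∈ ({0, n} : Finset G) := fun a _ => by simpa using hf a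
  have hlt : ({0, n} : Finset G).card * 2 < s.card := by
    have := Finset.card_le_two (a := (0 : G)) (b := n)
    omega
  obtain ⟨v, -, hv⟩ := Finset.exists_lt_card_fiber_of_mul_lt_card_of_maps_to hmaps hlt
  obtain ⟨a, b, c, ha, hb, hc, hab, hac, hbc⟩ := Finset.two_lt_card_iff.mp hv
  simp only [Finset.mem_filter] at ha hb hc
  by_cases h : a - b = n
  · refine ⟨a - c, sub_ne_zero.mpr hac, fun h' => hbc ?_, by simp [ha.2, hc.2]⟩
    exact sub_right_injective (h.trans h'.symm)
  · exact ⟨a - b, sub_ne_zero.mpr hab, h, by simp [ha.2, hb.2]⟩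

/-- In a ring with at least five elements, left multiplication by a sink has trivial kernel. -/
theorem IsSink.eq_zero_of_mul_eq_zero (hcard : ∃ s : Finset R, 5 ≤ s.card)
    {x : R} (hx : IsSink x) {y : R} (hy : x * y = 0) :
    y = 0 := by
  have key : ∀ z : R, x * z = 0 → z = 0 ∨ z = x := fun z hz => by
    by_contra! h
    exact hx.2.2 ⟨z, ⟨h.1, Or.inr ⟨x, hx.1.1, hz⟩⟩, h.2, hz⟩
  rcases key y hy with h | rfl
  · exact h
  · obtain ⟨z, hz0, hzy, hz⟩ := AddMonoidHom.exists_map_eq_zero_of_forall_map_eq_or hcard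
      (AddMonoidHom.mulLeft y) y fun r => key _ (by simp [← mul_assoc, hy])
    exact absurd (key z hz) (by tauto)

/-- A left identity that is not a right identity yields a nonzero left annihilator of the ring. -/
theorem IsLeftId.exists_forall_mul_eq_zero {e : R}
    (he : IsLeftId e) (hr : ¬ IsRightId e) : ∃ n : R, n ≠ 0 ∧ ∀ x, n * x = 0 := by
  simp only [IsRightId, not_forall] at hr
  obtain ⟨a, ha⟩ := hr
  exact ⟨a * e - a, sub_ne_zero.mpr ha, fun x => by rw [sub_mul, mul_assoc, he x, sub_self]⟩

theorem IsLeftId.isSink {e n : R}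
    (he : IsLeftId e) (hn0 : n ≠ 0) (hn : ∀ x, n * x = 0) : IsSink e := by
  have he0 : e ≠ 0 := fun h => hn0 (by rw [← he n, h, zero_mul])
  refine ⟨⟨he0, Or.inr ⟨n, hn0, hn e⟩⟩, ⟨n, ⟨hn0, Or.inl ⟨e, he0, hn e⟩⟩, ?_, hn e⟩, ?_⟩
  · rintro rfl
    exact hn0 ((he n).symm.trans (hn n))
  · rintro ⟨y, hy, -, h⟩
    exact hy.1 ((he y).symm.trans h)

theorem not_isSource_of_forall_mul_eq_zero (hcard : ∃ s : Finset R, 5 ≤ s.card)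
    {n : R} (hn0 : n ≠ 0) (hn : ∀ x, n * x = 0) (x : R) :
    ¬ IsSource x := by
  rintro ⟨hx, -, hno⟩
  have key : ∀ y : R, y * x = 0 → y = 0 ∨ y = x := fun y hy => by
    by_contra! h
    exact hno ⟨y, ⟨h.1, Or.inl ⟨x, hx.1, hy⟩⟩, h.2, hy⟩
  obtain rfl : n = x := (key n (hn x)).resolve_left hn0
  obtain ⟨z, hz0, hzn, hz⟩ := AddMonoidHom.exists_map_eq_zero_of_forall_map_eq_or hcard
    (AddMonoidHom.mulRight n) n fun r => key _ (by simp [mul_assoc, hn])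
  exact absurd (key z hz) (by tauto)

theorem stmt17 {R : Type*} [NonUnitalRing R]
    (hcard : ∃ s : Finset R, 5 ≤ s.card) :
    ((∃ e : R, IsLeftId e ∧ ¬ IsRightId e) ↔
      ((∃ x : R, IsSink x) ∧
        ∃ x : R, IsSink x ∧ (fun s => x * s) '' {s : R | IsSink s} = {s : R | IsSink s})) ∧
    ((∃ e : R, IsLeftId e ∧ ¬ IsRightId e) →
      (¬ ∃ x : R, IsSource x) ∧ ∃ a b : R, a ≠ b ∧ IsSink a ∧ IsSink b) := by
  refine ⟨⟨?_, ?_⟩, ?_⟩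
  · rintro ⟨e, he, hr⟩
    obtain ⟨n, hn0, hn⟩ := he.exists_forall_mul_eq_zero hr
    have hs := he.isSink hn0 hn
    refine ⟨⟨e, hs⟩, e, hs, ?_⟩
    rw [show (fun s => e * s) = id from funext he, Set.image_id]
  · rintro ⟨-, x, hx, himage⟩
    obtain ⟨s, hs, hxs : x * s = x⟩ := himage.ge hx
    have hid : IsLeftId s := fun r => sub_eq_zero.mp <| hx.eq_zero_of_mul_eq_zero hcard <| by
      rw [mul_sub, ← mul_assoc, hxs, sub_self]
    obtain ⟨-, ⟨y, hy, -, hys⟩, -⟩ := hs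
    exact ⟨s, hid, fun h => hy.1 ((h y).symm.trans hys)⟩
  · rintro ⟨e, he, hr⟩
    obtain ⟨n, hn0, hn⟩ := he.exists_forall_mul_eq_zero hr
    have hen : IsLeftId (e + n) := fun x => by rw [add_mul, he x, hn x, add_zero]
    refine ⟨fun ⟨x, hx⟩ => not_isSource_of_forall_mul_eq_zero hcard hn0 hn x hx, e, e + n, ?_,
      he.isSink hn0 hn, hen.isSink hn0 hn⟩
    simpa using hn0
end
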